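/- arXiv:2010.00261 — 2 statements merged into one kernel-verified Lean document; each statement's English description precedes it below -/
import Mathlib

section
/- Let N ≥ 1 and let x, y ∈ ℝ^N be nonzero vectors. Let w = (w_1, …, w_N) be a random vector whose coordinates are independent standard normal random variables (i.e., w is distributed according to the product of N standard Gaussian measures on ℝ). Then the probability of the event that the signs of ⟨w, x⟩ and ⟨w, y⟩ differ, i.e., the measure of the set {w : (0 < ⟨w, x⟩) ≠ (0 < ⟨w, y⟩)}, equals (1/π)·arccos(⟨x, y⟩/(‖x‖₂·‖y‖₂)). -/
open MeasureTheory ProbabilityTheory Real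

/-- The radial constant. -/
noncomputable def gwC : ENNReal :=
  ∫⁻ r in Set.Ioi (0:ℝ), ENNReal.ofReal r * (gaussianPDF 0 1 r * gaussianPDF 0 1 0)

lemma gw_pdf (r φ : ℝ) : gaussianPDF 0 1 (r * cos φ) * gaussianPDF 0 1 (r * sin φ)
    = gaussianPDF 0 1 r * gaussianPDF 0 1 0 := by
  simp only [gaussianPDF]
  rw [← ENNReal.ofReal_mul (gaussianPDFReal_nonneg _ _ _),
    ← ENNReal.ofReal_mul (gaussianPDFReal_nonneg _ _ _)]
  congr 1
  simp only [gaussianPDFReal]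
  rw [mul_mul_mul_comm, ← Real.exp_add, mul_mul_mul_comm _ _ _ (rexp (-(0 - 0) ^ 2 / _)),
    ← Real.exp_add]
  congr 2
  have := Real.sin_sq_add_cos_sq φ
  simp only [NNReal.coe_one]
  linear_combination (-r^2/2) * this

lemma gw_cone (S : Set (ℝ × ℝ)) (hS : MeasurableSet S) (Θ : Set ℝ) (hΘ : MeasurableSet Θ)
    (hsub : Θ ⊆ Set.Ioo (-π) π)
    (h : ∀ r φ : ℝ, 0 < r → φ ∈ Set.Ioo (-π) π → ((r * cos φ, r * sin φ) ∈ S ↔ φ ∈ Θ)) :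
    ((gaussianReal 0 1).prod (gaussianReal 0 1)) S = gwC * volume Θ := by
  rw [gaussianReal_of_var_ne_zero _ one_ne_zero,
    prod_withDensity (measurable_gaussianPDF _ _) (measurable_gaussianPDF _ _),
    withDensity_apply _ hS, ← lintegral_indicator hS, ← Measure.volume_eq_prod,
    ← lintegral_comp_polarCoord_symm]
  have e : ∫⁻ (p : ℝ × ℝ) in polarCoord.target, ENNReal.ofReal p.1 •
      S.indicator (fun z : ℝ × ℝ => gaussianPDF 0 1 z.1 * gaussianPDF 0 1 z.2) (polarCoord.symm p)
      = ∫⁻ (p : ℝ × ℝ) in Set.Ioi (0:ℝ) ×ˢ Set.Ioo (-π) π,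
        (ENNReal.ofReal p.1 * (gaussianPDF 0 1 p.1 * gaussianPDF 0 1 0)) *
          Θ.indicator (fun _ => 1) p.2 := by
    apply setLIntegral_congr_fun (measurableSet_Ioi.prod measurableSet_Ioo)
    rintro ⟨r, φ⟩ ⟨hr, hφ⟩
    have := h r φ hr hφ
    simp only [polarCoord_symm_apply, smul_eq_mul]
    by_cases hm : φ ∈ Θ
    · rw [Set.indicator_of_mem (this.2 hm), Set.indicator_of_mem hm, gw_pdf, mul_one]
    · rw [Set.indicator_of_notMem (fun h' => hm (this.1 h')), Set.indicator_of_notMem hm]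
      simp
  rw [e, Measure.volume_eq_prod, ← Measure.prod_restrict,
    lintegral_prod_mul (f := fun r => ENNReal.ofReal r * (gaussianPDF 0 1 r * gaussianPDF 0 1 0))
      (g := Θ.indicator (fun _ => 1))]
  · rw [lintegral_indicator hΘ]
    simp [gwC, Measure.restrict_restrict hΘ, Set.inter_eq_left.2 hsub]
  · exact (ENNReal.measurable_ofReal.mul
      ((measurable_gaussianPDF 0 1).mul_const _)).aemeasurable
  · exact (measurable_const.indicator hΘ).aemeasurable

lemma gw_C : gwC = ENNReal.ofReal (1 / (2 * π)) := by
  have := gw_cone Set.univ .univ (Set.Ioo (-π) π) measurableSet_Ioo subset_rfl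
    (fun r φ _ h => by simp [h.1, h.2])
  rw [measure_univ, Real.volume_Ioo] at this
  have hp := Real.pi_pos
  rw [one_div, ENNReal.ofReal_inv_of_pos (by positivity)]
  refine ENNReal.eq_inv_of_mul_eq_one_left ?_
  rw [this]; ring_nf

lemma gw_cos_pos {t : ℝ} (h1 : -(3 * π / 2) ≤ t) (h2 : t ≤ 3 * π / 2) :
    0 < cos t ↔ -(π / 2) < t ∧ t < π / 2 := by
  constructor
  · intro h
    constructor
    · by_contra! hc
      have := Real.cos_nonpos_of_pi_div_two_le_of_le (x := -t) (by linarith) (by linarith)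
      rw [Real.cos_neg] at this; linarith
    · by_contra! hc
      have := Real.cos_nonpos_of_pi_div_two_le_of_le (x := t) (by linarith) (by linarith)
      linarith
  · rintro ⟨h, h'⟩; exact Real.cos_pos_of_mem_Ioo ⟨h, h'⟩

lemma gw_two (θ : ℝ) (h0 : 0 ≤ θ) (h1 : θ ≤ π) :
    ((gaussianReal 0 1).prod (gaussianReal 0 1))
      {z : ℝ × ℝ | (0 < cos (θ/2) * z.1 - sin (θ/2) * z.2) ≠
        (0 < cos (θ/2) * z.1 + sin (θ/2) * z.2)} = ENNReal.ofReal ((1 / π) * θ) := by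
  have hp := Real.pi_pos
  set A := Set.Ioo (-(π/2) - θ/2) (π/2 - θ/2) with hA
  set B := Set.Ioo (-(π/2) + θ/2) (π/2 + θ/2) with hB
  rw [gw_cone _ ?_ (symmDiff A B)
    ((measurableSet_Ioo).symmDiff measurableSet_Ioo) ?_ ?_, gw_C]
  · have hv : volume (symmDiff A B) = ENNReal.ofReal (2 * θ) := by
      apply le_antisymm
      · have : symmDiff A B ⊆ Set.Icc (-(π/2) - θ/2) (-(π/2) + θ/2) ∪
            Set.Icc (π/2 - θ/2) (π/2 + θ/2) := by
          intro t ht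
          simp only [Set.mem_symmDiff, hA, hB, Set.mem_Ioo, Set.mem_union, Set.mem_Icc] at ht ⊢
          grind
        refine (measure_mono this).trans ((measure_union_le _ _).trans ?_)
        rw [Real.volume_Icc, Real.volume_Icc, ← ENNReal.ofReal_add (by linarith) (by linarith)]
        apply le_of_eq; congr 1; ring
      · have : Set.Ioo (-(π/2) - θ/2) (-(π/2) + θ/2) ∪
            Set.Ioo (π/2 - θ/2) (π/2 + θ/2) ⊆ symmDiff A B := by
          intro t ht
          simp only [Set.mem_symmDiff, hA, hB, Set.mem_Ioo, Set.mem_union] at ht ⊢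
          grind
        refine le_trans ?_ (measure_mono this)
        rw [measure_union ?_ measurableSet_Ioo, Real.volume_Ioo, Real.volume_Ioo,
          ← ENNReal.ofReal_add (by linarith) (by linarith)]
        · apply le_of_eq; congr 1; ring
        · rw [Set.disjoint_left]
          intro t ht ht'
          have := ht.2
          have := ht'.1
          linarith
    rw [hv, ← ENNReal.ofReal_mul (by positivity)]
    congr 1; field_simp
  · have m1 : MeasurableSet {z : ℝ × ℝ | 0 < cos (θ/2) * z.1 - sin (θ/2) * z.2} :=
      measurableSet_lt measurable_const (by fun_prop)
    have m2 : MeasurableSet {z : ℝ × ℝ | 0 < cos (θ/2) * z.1 + sin (θ/2) * z.2} :=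
      measurableSet_lt measurable_const (by fun_prop)
    convert m1.symmDiff m2 using 1
    ext z
    simp only [Set.mem_symmDiff, Set.mem_ofPred_eq, ne_eq, eq_iff_iff]
    tauto
  · intro t ht
    simp only [Set.mem_symmDiff, hA, hB, Set.mem_Ioo] at ht ⊢
    grind
  · intro r φ hr hφ
    have e1 : cos (θ/2) * (r * cos φ) - sin (θ/2) * (r * sin φ) = r * cos (φ + θ/2) := by
      rw [Real.cos_add]; ring
    have e2 : cos (θ/2) * (r * cos φ) + sin (θ/2) * (r * sin φ) = r * cos (φ - θ/2) := by
      rw [Real.cos_sub]; ring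
    have := hφ.1
    have := hφ.2
    simp only [Set.mem_symmDiff, Set.mem_ofPred_eq, e1, e2, mul_pos_iff_of_pos_left hr, ne_eq,
      eq_iff_iff]
    rw [gw_cos_pos (by linarith) (by linarith), gw_cos_pos (by linarith) (by linarith)]
    simp only [hA, hB, Set.mem_Ioo]
    grind

open scoped RealInnerProductSpace

lemma gw_key (L : StrongDual ℝ (ℝ × ℝ)) (G : Type*) [NormedAddCommGroup G]
      [InnerProductSpace ℝ G] (u v : G) :
      ‖L.comp ((innerSL ℝ u).prod (innerSL ℝ v))‖ ^ 2 =
        (L (1, 0))^2 * ‖u‖^2 + 2 * (L (1,0)) * (L (0,1)) * ⟪u, v⟫ + (L (0,1))^2 * ‖v‖^2 := by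
    have : L.comp ((innerSL ℝ u).prod (innerSL ℝ v)) =
        innerSL ℝ (L (1,0) • u + L (0,1) • v) := by
      ext w
      have e : ((⟪u, w⟫, ⟪v, w⟫) : ℝ × ℝ) = ⟪u, w⟫ • ((1:ℝ), (0:ℝ)) + ⟪v, w⟫ • ((0:ℝ), (1:ℝ)) := by
        simp
      simp only [ContinuousLinearMap.comp_apply, ContinuousLinearMap.prod_apply, innerSL_apply_apply]
      rw [e, map_add, map_smul, map_smul, inner_add_left, real_inner_smul_left,
        real_inner_smul_left]
      simp [mul_comm]
    rw [this, innerSL_apply_norm, norm_add_sq_real, norm_smul, norm_smul, real_inner_smul_left,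
      real_inner_smul_right, mul_pow, mul_pow, Real.norm_eq_abs, Real.norm_eq_abs, sq_abs, sq_abs]
    ring

lemma gw_map {E F : Type*} [NormedAddCommGroup E] [InnerProductSpace ℝ E] [FiniteDimensional ℝ E]
    [MeasurableSpace E] [BorelSpace E]
    [NormedAddCommGroup F] [InnerProductSpace ℝ F] [FiniteDimensional ℝ F]
    [MeasurableSpace F] [BorelSpace F] (u v : E) (u' v' : F) (hu : ‖u‖ = ‖u'‖) (hv : ‖v‖ = ‖v'‖)
    (huv : ⟪u, v⟫ = ⟪u', v'⟫) :
    (stdGaussian E).map (fun w => (⟪u, w⟫, ⟪v, w⟫)) =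
    (stdGaussian F).map (fun w => (⟪u', w⟫, ⟪v', w⟫)) := by
  apply Measure.ext_of_charFunDual
  ext L
  rw [show (fun w : E => (⟪u, w⟫, ⟪v, w⟫)) = ((innerSL ℝ u).prod (innerSL ℝ v)) from rfl,
    show (fun w : F => (⟪u', w⟫, ⟪v', w⟫)) = ((innerSL ℝ u').prod (innerSL ℝ v')) from rfl,
    charFunDual_map, charFunDual_map, charFunDual_stdGaussian, charFunDual_stdGaussian]
  congr 3
  norm_cast
  rw [gw_key L E, gw_key L F, hu, hv, huv]

/-- Goemans–Williamson: for nonzero `x y : ℝ^N` and `w` with i.i.d. standard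
Gaussian coordinates, the probability that the signs of `⟨w, x⟩` and `⟨w, y⟩`
differ equals `(1/π) · arccos(⟨x, y⟩ / (‖x‖₂ · ‖y‖₂))`. -/
theorem gw_sign_collision (N : ℕ) (hN : 1 ≤ N) (x y : Fin N → ℝ)
    (hx : x ≠ 0) (hy : y ≠ 0) :
    (Measure.pi fun _ : Fin N => gaussianReal 0 1)
      {w : Fin N → ℝ | (0 < ∑ i, w i * x i) ≠ (0 < ∑ i, w i * y i)} =
    ENNReal.ofReal ((1 / π) * arccos ((∑ i, x i * y i) /
      (Real.sqrt (∑ i, x i ^ 2) * Real.sqrt (∑ i, y i ^ 2)))) := by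
  set X : EuclideanSpace ℝ (Fin N) := WithLp.toLp 2 x with hX
  set Y : EuclideanSpace ℝ (Fin N) := WithLp.toLp 2 y with hY
  have nX : Real.sqrt (∑ i, x i ^ 2) = ‖X‖ := by simp [EuclideanSpace.norm_eq, hX]
  have nY : Real.sqrt (∑ i, y i ^ 2) = ‖Y‖ := by simp [EuclideanSpace.norm_eq, hY]
  have iXY : ∑ i, x i * y i = ⟪X, Y⟫ := by simp [PiLp.inner_apply, hX, hY, mul_comm]
  have X0 : 0 < ‖X‖ := by rw [norm_pos_iff, hX]; simpa using hx
  have Y0 : 0 < ‖Y‖ := by rw [norm_pos_iff, hY]; simpa using hy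
  rw [nX, nY, iXY]
  set θ := arccos (⟪X, Y⟫ / (‖X‖ * ‖Y‖)) with hθ
  have hcos : cos θ = ⟪X, Y⟫ / (‖X‖ * ‖Y‖) := InnerProductGeometry.cos_angle X Y
  set T : Set (ℝ × ℝ) := {p | (0 < p.1) ≠ (0 < p.2)} with hT
  have mT : MeasurableSet T := by
    have m1 : MeasurableSet {z : ℝ × ℝ | 0 < z.1} :=
      measurableSet_lt measurable_const (by fun_prop)
    have m2 : MeasurableSet {z : ℝ × ℝ | 0 < z.2} :=
      measurableSet_lt measurable_const (by fun_prop)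
    convert m1.symmDiff m2 using 1
    ext z
    simp only [hT, Set.mem_symmDiff, Set.mem_ofPred_eq, ne_eq, eq_iff_iff]
    tauto
  set U : EuclideanSpace ℝ (Fin 2) := !₂[cos (θ/2), -sin (θ/2)] with hU
  set V : EuclideanSpace ℝ (Fin 2) := !₂[cos (θ/2), sin (θ/2)] with hV
  have hm := gw_map (‖X‖⁻¹ • X) (‖Y‖⁻¹ • Y) U V
    (by rw [norm_smul, norm_inv, norm_norm, inv_mul_cancel₀ X0.ne']
        simp [EuclideanSpace.norm_eq, hU])
    (by rw [norm_smul, norm_inv, norm_norm, inv_mul_cancel₀ Y0.ne']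
        simp [EuclideanSpace.norm_eq, hV])
    (by rw [real_inner_smul_left, real_inner_smul_right]
        have h2 : cos θ = cos (θ/2) * cos (θ/2) - sin (θ/2) * sin (θ/2) := by
          rw [← Real.cos_add]; ring_nf
        have : ⟪U, V⟫ = cos θ := by
          rw [h2]; simp [PiLp.inner_apply, hU, hV, Fin.sum_univ_two]; ring
        rw [this, hcos]; field_simp)
  have hm2 := congrArg (fun μ => μ T) hm
  simp only at hm2
  rw [Measure.map_apply (by fun_prop) mT, Measure.map_apply (by fun_prop) mT,
    ← map_pi_eq_stdGaussian, ← map_pi_eq_stdGaussian,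
    Measure.map_apply (by fun_prop) ((by fun_prop : Measurable _) mT),
    Measure.map_apply (by fun_prop) ((by fun_prop : Measurable _) mT)] at hm2
  have h2 := gw_two θ (Real.arccos_nonneg _) (Real.arccos_le_pi _)
  rw [← h2]
  have hmp := measurePreserving_finTwoArrow (gaussianReal 0 1)
  rw [← hmp.measure_preimage_equiv]
  convert hm2 using 2
  · ext w
    simp only [Set.mem_ofPred_eq, Set.mem_preimage, hT, real_inner_smul_left,
      mul_pos_iff_of_pos_left (inv_pos.2 X0), mul_pos_iff_of_pos_left (inv_pos.2 Y0)]
    simp [PiLp.inner_apply, hX, hY]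
  · ext w
    simp only [Set.mem_ofPred_eq, Set.mem_preimage, hT, hU, hV]
    simp [PiLp.inner_apply, Fin.sum_univ_two, mul_comm, sub_eq_add_neg]
end

section
/- Let N ≥ 1, D ≥ 1, and let x, y ∈ ℝ^N be nonzero vectors. Let W_1, …, W_D be independent random vectors in ℝ^N, each with i.i.d. standard normal coordinates (i.e., distributed according to the D-fold product of the N-dimensional standard Gaussian product measure). Define the normalized Hamming distance between the binary signatures of x and y as (1/D)·#{d ∈ {1,…,D} : (0 < ⟨W_d, x⟩) ≠ (0 < ⟨W_d, y⟩)}. Then the expected value of this normalized Hamming distance equals (1/π)·arccos(⟨x, y⟩/(‖x‖₂·‖y‖₂)). -/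
open MeasureTheory ProbabilityTheory Real Classical

noncomputable def sgnInd (p : ℝ × ℝ) : ℝ := if (0 < p.1) ≠ (0 < p.2) then 1 else 0

lemma measurable_sgnInd : Measurable sgnInd := by
  unfold sgnInd
  refine Measurable.ite ?_ measurable_const measurable_const
  have h1 : MeasurableSet {p : ℝ × ℝ | 0 < p.1} := measurableSet_lt measurable_const measurable_fst
  have h2 : MeasurableSet {p : ℝ × ℝ | 0 < p.2} := measurableSet_lt measurable_const measurable_snd
  have : {p : ℝ × ℝ | (0 < p.1) ≠ (0 < p.2)} = symmDiff {p : ℝ × ℝ | 0 < p.1} {p : ℝ × ℝ | 0 < p.2} := by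
    ext p
    simp only [Set.mem_symmDiff, Set.mem_ofPred_eq, ne_eq, eq_iff_iff]
    tauto
  rw [this]
  exact h1.symmDiff h2

lemma sgnInd_mul (a b p q : ℝ) (ha : 0 < a) (hb : 0 < b) :
    sgnInd (a * p, b * q) = sgnInd (p, q) := by
  simp [sgnInd, mul_pos_iff_of_pos_left, ha, hb]

lemma norm_sgnInd_le (p : ℝ × ℝ) : ‖sgnInd p‖ ≤ 1 := by
  unfold sgnInd; split_ifs <;> simp

section gram
variable {E F : Type*} [NormedAddCommGroup E] [InnerProductSpace ℝ E] [FiniteDimensional ℝ E]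
  [MeasurableSpace E] [BorelSpace E]
  [NormedAddCommGroup F] [InnerProductSpace ℝ F] [FiniteDimensional ℝ F]
  [MeasurableSpace F] [BorelSpace F]

lemma charFunDual_pair (x y : E) (L : StrongDual ℝ (ℝ × ℝ)) :
    charFunDual ((stdGaussian E).map ((innerSL ℝ x).prod (innerSL ℝ y))) L =
      Complex.exp (- ((‖x‖^2 * L (1,0)^2 + 2 * (L (1,0)) * (L (0,1)) * inner ℝ x y
        + ‖y‖^2 * L (0,1)^2 : ℝ)) / 2) := by
  rw [charFunDual_map, charFunDual_stdGaussian]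
  have h : L.comp ((innerSL ℝ x).prod (innerSL ℝ y)) =
      innerSL ℝ (L (1,0) • x + L (0,1) • y) := by
    ext w
    have : ((inner ℝ x w : ℝ), (inner ℝ y w : ℝ)) =
        (inner ℝ x w : ℝ) • ((1:ℝ),(0:ℝ)) + (inner ℝ y w : ℝ) • ((0:ℝ),(1:ℝ)) := by simp
    simp only [ContinuousLinearMap.comp_apply, ContinuousLinearMap.prod_apply, innerSL_apply_apply]
    rw [this, map_add, map_smul, map_smul, inner_add_left, real_inner_smul_left,
      real_inner_smul_left]
    simp only [smul_eq_mul]; ring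
  rw [h, innerSL_apply_norm, ← Complex.ofReal_pow, norm_add_sq_real, norm_smul, norm_smul,
    real_inner_smul_left, real_inner_smul_right, mul_pow, mul_pow, norm_eq_abs, norm_eq_abs,
    sq_abs, sq_abs]
  congr 4
  ring

lemma pair_law (x y : E) (x' y' : F) (hx : ‖x‖ = ‖x'‖) (hy : ‖y‖ = ‖y'‖)
    (hxy : (inner ℝ x y : ℝ) = inner ℝ x' y') :
    (stdGaussian E).map ((innerSL ℝ x).prod (innerSL ℝ y)) =
    (stdGaussian F).map ((innerSL ℝ x').prod (innerSL ℝ y')) := by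
  apply Measure.ext_of_charFunDual
  ext L
  rw [charFunDual_pair, charFunDual_pair, hx, hy, hxy]
end gram

lemma angular (θ : ℝ) (h0 : 0 ≤ θ) (h1 : θ ≤ π) :
    ∫ φ in Set.Ioo (-π) π, sgnInd (cos φ, cos (φ - θ)) = 2 * θ := by
  have hpi := pi_pos
  rw [← integral_Ioc_eq_integral_Ioo, ← intervalIntegral.integral_of_le (by linarith)]
  set f : ℝ → ℝ := fun φ => sgnInd (cos φ, cos (φ - θ)) with hf
  have hper : Function.Periodic f (2 * π) := by
    intro φ
    simp only [hf, cos_add_two_pi]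
    rw [show φ + 2 * π - θ = (φ - θ) + 2 * π by ring, cos_add_two_pi]
  have hm : Measurable f := measurable_sgnInd.comp (by fun_prop)
  have hint : ∀ a b, IntervalIntegrable f volume a b := fun a b =>
    (intervalIntegrable_const (c := (1:ℝ))).mono_fun hm.aestronglyMeasurable
      (Filter.Eventually.of_forall fun φ => by simpa using norm_sgnInd_le _)
  have e := hper.intervalIntegral_add_eq (-π) (-(π/2))
  rw [show -π + 2 * π = π by ring] at e
  rw [e]
  rw [← intervalIntegral.integral_add_adjacent_intervals (hint _ (θ - π/2)) (hint _ _),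
    ← intervalIntegral.integral_add_adjacent_intervals (hint (θ - π/2) (π/2)) (hint _ _),
    ← intervalIntegral.integral_add_adjacent_intervals (hint (π/2) (θ+π/2)) (hint _ _)]
  have c1 : ∀ φ, -(π/2) < φ → φ < π/2 → 0 < cos φ := fun φ a b => cos_pos_of_mem_Ioo ⟨a, b⟩
  have c2 : ∀ φ, π/2 < φ → φ < 3*π/2 → ¬ 0 < cos φ := fun φ a b =>
    not_lt.2 (cos_nonpos_of_pi_div_two_le_of_le a.le (by linarith))
  have c3 : ∀ φ, -(3*π/2) < φ → φ < -(π/2) → ¬ 0 < cos φ := fun φ a b => by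
    rw [← cos_neg]; exact c2 _ (by linarith) (by linarith)
  have key : ∀ a b c, a ≤ b → (∀ φ, a < φ → φ < b → f φ = c) → ∫ φ in a..b, f φ = (b - a) * c := by
    intro a b c hab h
    rw [intervalIntegral.integral_of_le hab, integral_Ioc_eq_integral_Ioo,
      setIntegral_congr_fun (g := fun _ => c) measurableSet_Ioo (fun φ hφ => h φ hφ.1 hφ.2)]
    simp [hab]
  rw [key _ _ 1 (by linarith), key _ _ 0 (by linarith), key _ _ 1 (by linarith),
    key _ _ 0 (by linarith)]
  · ring
  · intro φ a b
    have := c2 φ (by linarith) (by linarith)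
    have := c2 (φ - θ) (by linarith) (by linarith)
    simp [sgnInd, *]
  · intro φ a b
    have := c2 φ (by linarith) (by linarith)
    have := c1 (φ - θ) (by linarith) (by linarith)
    simp [sgnInd, *]
  · intro φ a b
    have := c1 φ (by linarith) (by linarith)
    have := c1 (φ - θ) (by linarith) (by linarith)
    simp [sgnInd, *]
  · intro φ a b
    have := c1 φ (by linarith) (by linarith)
    have := c3 (φ - θ) (by linarith) (by linarith)
    simp [sgnInd, *]

lemma radial : ∫ r in Set.Ioi (0:ℝ), r * rexp (-(r^2/2)) = 1 := by
  have := integral_rpow_mul_exp_neg_mul_rpow (p := 2) (q := 1) (b := 1/2) (by norm_num) (by norm_num) (by norm_num)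
  norm_num at this
  rw [← this]
  refine setIntegral_congr_fun measurableSet_Ioi fun r hr => ?_
  ring_nf

lemma planar (θ : ℝ) (h0 : 0 ≤ θ) (h1 : θ ≤ π) :
    ∫ p : ℝ × ℝ, sgnInd (p.1, cos θ * p.1 + sin θ * p.2)
      ∂((gaussianReal 0 1).prod (gaussianReal 0 1)) = (1 / π) * θ := by
  have hpi := pi_pos
  rw [gaussianReal_of_var_ne_zero _ one_ne_zero,
    prod_withDensity (measurable_gaussianPDF _ _) (measurable_gaussianPDF _ _),
    integral_withDensity_eq_integral_toReal_smul
      (by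
        have := measurable_gaussianPDF 0 1
        exact (this.comp measurable_fst).mul (this.comp measurable_snd))
      (ae_of_all _ fun _ ↦ ENNReal.mul_lt_top gaussianPDF_lt_top gaussianPDF_lt_top)]
  change ∫ p : ℝ × ℝ, _ = _
  rw [← integral_comp_polarCoord_symm]
  have : ∀ p ∈ polarCoord.target, p.1 • (fun x : ℝ × ℝ =>
      (gaussianPDF 0 1 x.1 * gaussianPDF 0 1 x.2).toReal •
        sgnInd (x.1, cos θ * x.1 + sin θ * x.2)) (polarCoord.symm p) =
      (p.1 * rexp (-(p.1^2/2))) * ((1 / (2 * π)) * sgnInd (cos p.2, cos (p.2 - θ))) := by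
    rintro ⟨r, φ⟩ ⟨hr, -⟩
    have hr : 0 < r := hr
    simp only [polarCoord_symm_apply, ENNReal.toReal_mul, toReal_gaussianPDF, smul_eq_mul]
    rw [show cos θ * (r * cos φ) + sin θ * (r * sin φ) = r * cos (φ - θ) by rw [cos_sub]; ring,
      sgnInd_mul _ _ _ _ hr hr]
    simp only [gaussianPDFReal, NNReal.coe_one, mul_one, sub_zero]
    have e1 : rexp (-(r * cos φ) ^ 2 / 2) * rexp (-(r * sin φ) ^ 2 / 2) = rexp (-(r^2/2)) := by
      rw [← exp_add]
      congr 1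
      linear_combination (-(r^2/2)) * (cos_sq_add_sin_sq φ)
    have e2 : (√(2 * π))⁻¹ * (√(2 * π))⁻¹ = 1 / (2 * π) := by
      rw [← mul_inv, mul_self_sqrt (by positivity), one_div]
    rw [← e1, ← e2]
    ring
  rw [setIntegral_congr_fun polarCoord.open_target.measurableSet this]
  rw [polarCoord_target, Measure.volume_eq_prod, setIntegral_prod_mul
    (fun r : ℝ => r * rexp (-(r^2/2))) (fun φ => (1 / (2 * π)) * sgnInd (cos φ, cos (φ - θ))),
    radial, integral_const_mul, angular θ h0 h1]
  field_simp

lemma pi_pair {ι : Type*} [Fintype ι] (x y : EuclideanSpace ℝ ι) :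
    ∫ w : ι → ℝ, sgnInd (∑ i, w i * x i, ∑ i, w i * y i)
      ∂(Measure.pi fun _ : ι => gaussianReal 0 1) =
    ∫ p, sgnInd p ∂((stdGaussian (EuclideanSpace ℝ ι)).map ((innerSL ℝ x).prod (innerSL ℝ y))) := by
  rw [← map_pi_eq_stdGaussian, Measure.map_map (by fun_prop) (by fun_prop),
    integral_map (by fun_prop) measurable_sgnInd.aestronglyMeasurable]
  simp [PiLp.inner_apply]

lemma single {N : ℕ} (x y : EuclideanSpace ℝ (Fin N)) (hx : x ≠ 0) (hy : y ≠ 0) :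
    ∫ w : Fin N → ℝ, sgnInd (∑ i, w i * x i, ∑ i, w i * y i)
      ∂(Measure.pi fun _ : Fin N => gaussianReal 0 1) =
    (1 / π) * InnerProductGeometry.angle x y := by
  set θ := InnerProductGeometry.angle x y with hθ
  have hx' := norm_pos_iff.2 hx
  have hy' := norm_pos_iff.2 hy
  let x' : EuclideanSpace ℝ (Fin 2) := !₂[‖x‖, 0]
  let y' : EuclideanSpace ℝ (Fin 2) := !₂[‖y‖ * cos θ, ‖y‖ * sin θ]
  have a1 : ‖x‖ = ‖x'‖ := by simp [x', EuclideanSpace.norm_eq]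
  have a2 : ‖y‖ = ‖y'‖ := by
    simp only [y', EuclideanSpace.norm_eq, Fin.sum_univ_two]
    simp [mul_pow, ← mul_add]
  have a3 : (inner ℝ x y : ℝ) = inner ℝ x' y' := by
    rw [← InnerProductGeometry.cos_angle_mul_norm_mul_norm]
    simp [x', y', PiLp.inner_apply, ← hθ]
    ring
  rw [pi_pair, pair_law x y x' y' a1 a2 a3, ← pi_pair,
    ← planar θ (InnerProductGeometry.angle_nonneg _ _) (InnerProductGeometry.angle_le_pi _ _),
    ← (measurePreserving_finTwoArrow (gaussianReal 0 1)).integral_comp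
      MeasurableEquiv.finTwoArrow.measurableEmbedding]
  congr 1
  ext w
  simp only [Fin.sum_univ_two, x', y']
  refine Eq.trans ?_ (sgnInd_mul ‖x‖ ‖y‖ _ _ hx' hy')
  congr 2
  · simp [MeasurableEquiv.finTwoArrow]; ring
  · simp [MeasurableEquiv.finTwoArrow]; ring

theorem expected_hamming_distance (N D : ℕ) (hN : 1 ≤ N) (hD : 1 ≤ D)
    (x y : Fin N → ℝ) (hx : x ≠ 0) (hy : y ≠ 0) :
    ∫ W : Fin D → Fin N → ℝ,
        ((Finset.univ.filter fun d : Fin D =>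
            (0 < ∑ i, W d i * x i) ≠ (0 < ∑ i, W d i * y i)).card : ℝ) / D
      ∂(Measure.pi fun _ : Fin D => Measure.pi fun _ : Fin N => gaussianReal 0 1) =
    (1 / π) * arccos ((∑ i, x i * y i) /
      (Real.sqrt (∑ i, x i ^ 2) * Real.sqrt (∑ i, y i ^ 2))) := by
  have hs := single (WithLp.toLp 2 x) (WithLp.toLp 2 y) (by simpa using hx) (by simpa using hy)
  have hang : InnerProductGeometry.angle (WithLp.toLp 2 x) (WithLp.toLp 2 y) =
      arccos ((∑ i, x i * y i) / (Real.sqrt (∑ i, x i ^ 2) * Real.sqrt (∑ i, y i ^ 2))) := by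
    simp [InnerProductGeometry.angle, EuclideanSpace.norm_eq, PiLp.inner_apply, mul_comm]
  rw [hang] at hs
  rw [← hs]
  set g : (Fin N → ℝ) → ℝ := fun w => sgnInd (∑ i, w i * x i, ∑ i, w i * y i) with hg
  have hgm : Measurable g := measurable_sgnInd.comp (by fun_prop)
  have h1 : ∀ W : Fin D → Fin N → ℝ, ((Finset.univ.filter fun d : Fin D =>
            (0 < ∑ i, W d i * x i) ≠ (0 < ∑ i, W d i * y i)).card : ℝ) / D
      = (∑ d, g (W d)) / D := by
    intro W
    simp only [hg, sgnInd, Finset.card_filter, Nat.cast_sum, Nat.cast_ite, Nat.cast_one,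
      Nat.cast_zero]
  simp_rw [h1]
  rw [integral_div, integral_finsetSum]
  · have : ∀ d : Fin D, ∫ W : Fin D → Fin N → ℝ, g (W d)
        ∂(Measure.pi fun _ : Fin D => Measure.pi fun _ : Fin N => gaussianReal 0 1) =
        ∫ w, g w ∂(Measure.pi fun _ : Fin N => gaussianReal 0 1) := by
      intro d
      have mp := measurePreserving_eval
        (fun _ : Fin D => Measure.pi fun _ : Fin N => gaussianReal 0 1) d
      have e := integral_map mp.measurable.aemeasurable
        (μ := Measure.pi fun _ : Fin D => Measure.pi fun _ : Fin N => gaussianReal 0 1)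
        (f := g) hgm.aestronglyMeasurable
      rw [mp.map_eq] at e
      exact e.symm
    simp_rw [this]
    have hD' : (D : ℝ) ≠ 0 := by positivity
    simp only [Finset.sum_const, Finset.card_univ, Fintype.card_fin, nsmul_eq_mul]
    field_simp
  · intro d _
    exact Integrable.of_bound (hgm.comp (measurable_pi_apply d)).aestronglyMeasurable 1
      (ae_of_all _ fun W => norm_sgnInd_le _)
end
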